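/- Let τ ∈ P^{KS}_φ(M), i.e. τ : M → M is a positive linear map with τ(x*)τ(x) ≤ τ(x*x) for all x ∈ M and φ(τ(x)) ≤ φ(x) for all positive x ∈ M, and let N = {x ∈ M : τ(x) = x}. Then for every x ∈ N one has τ(x*x) = x*x, and for all x, y ∈ N one has τ(x*y) = τ(x*)τ(y) = x*y; consequently N is a ⋆-subalgebra of M (closed under adjoints and products). -/

import Mathlib

open scoped ComplexOrder
open Filter Topology

noncomputable section

local notation "⟪" x ", " y "⟫" => @inner ℂ _ _ x y

variable {H : Type*} [NormedAddCommGroup H] [InnerProductSpace ℂ H] [CompleteSpace H]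

/-- `ζ` is a cyclic vector for the von Neumann algebra `M`. -/
def IsCyclicVector (M : VonNeumannAlgebra H) (ζ : H) : Prop :=
  Dense (Submodule.span ℂ {v : H | ∃ x ∈ M, v = x ζ} : Set H)

/-- `ζ` is a separating vector for the von Neumann algebra `M`. -/
def IsSeparatingVector (M : VonNeumannAlgebra H) (ζ : H) : Prop :=
  ∀ x ∈ M, x ζ = 0 → x = 0

/-- `τ` maps `M` into `M` and takes positive elements of `M` to positive operators. -/
def IsPositiveMapOn (M : VonNeumannAlgebra H)
    (τ : (H →L[ℂ] H) →ₗ[ℂ] (H →L[ℂ] H)) : Prop :=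
  (∀ x ∈ M, τ x ∈ M) ∧ ∀ x ∈ M, x.IsPositive → (τ x).IsPositive

/-- Membership in `P^{1/2}_φ(M)` where `φ = ⟨ζ, · ζ⟩`: a positive map on `M` with
`τ(1) ≤ 1`, `φ ∘ τ ≤ φ` on positive elements, and `‖τ(x)ζ‖ ≤ ‖xζ‖`. -/
def MemPHalf (M : VonNeumannAlgebra H) (ζ : H)
    (τ : (H →L[ℂ] H) →ₗ[ℂ] (H →L[ℂ] H)) : Prop :=
  IsPositiveMapOn M τ ∧ ((1 : H →L[ℂ] H) - τ 1).IsPositive ∧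
    (∀ x ∈ M, x.IsPositive → ⟪ζ, τ x ζ⟫ ≤ ⟪ζ, x ζ⟫) ∧
    ∀ x ∈ M, ‖τ x ζ‖ ≤ ‖x ζ‖

/-- A vector on which the quadratic form of a positive operator vanishes lies in its kernel. -/
lemma ContinuousLinearMap.IsPositive.apply_eq_zero_of_inner_eq_zero {p : H →L[ℂ] H}
    (hp : p.IsPositive) {v : H} (h : ⟪v, p v⟫ = 0) : p v = 0 := by
  obtain ⟨s, rfl⟩ := CStarAlgebra.nonneg_iff_eq_star_mul_self.mp
    ((ContinuousLinearMap.nonneg_iff_isPositive p).mpr hp)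
  have h1 : ⟪s v, s v⟫ = 0 := by
    rwa [ContinuousLinearMap.star_eq_adjoint, mul_apply_eq_comp,
      ContinuousLinearMap.adjoint_inner_right] at h
  rw [mul_apply_eq_comp, inner_self_eq_zero.mp h1, map_zero]

lemma VonNeumannAlgebra.smul_mem {M : VonNeumannAlgebra H} (c : ℂ) {x : H →L[ℂ] H}
    (hx : x ∈ M) : c • x ∈ M :=
  M.toStarSubalgebra.smul_mem hx c

/-- A positive map sends self-adjoint elements to self-adjoint elements. -/
lemma IsPositiveMapOn.map_isSelfAdjoint {M : VonNeumannAlgebra H}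
    {τ : (H →L[ℂ] H) →ₗ[ℂ] (H →L[ℂ] H)} (hτ : IsPositiveMapOn M τ) {a : H →L[ℂ] H}
    (ha : a ∈ M) (hsa : IsSelfAdjoint a) : IsSelfAdjoint (τ a) := by
  have h1 : algebraMap ℂ (H →L[ℂ] H) ‖a‖ ∈ M :=
    M.toStarSubalgebra.algebraMap_mem _
  have h2 : (algebraMap ℂ (H →L[ℂ] H) ‖a‖).IsPositive := by
    rw [← ContinuousLinearMap.nonneg_iff_isPositive]
    exact algebraMap_nonneg _ (by simp)
  have h3 : (a + algebraMap ℂ (H →L[ℂ] H) ‖a‖).IsPositive := by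
    rw [← ContinuousLinearMap.nonneg_iff_isPositive, ← neg_le_iff_add_nonneg]
    exact hsa.neg_algebraMap_norm_le_self
  have h4 := (hτ.2 _ (add_mem ha h1) h3).isSelfAdjoint.sub (hτ.2 _ h1 h2).isSelfAdjoint
  rwa [← map_sub, add_sub_cancel_right] at h4

/-- A positive map commutes with the adjoint. -/
lemma IsPositiveMapOn.map_star {M : VonNeumannAlgebra H}
    {τ : (H →L[ℂ] H) →ₗ[ℂ] (H →L[ℂ] H)} (hτ : IsPositiveMapOn M τ) {x : H →L[ℂ] H}
    (hx : x ∈ M) : τ (star x) = star (τ x) := by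
  have h1 : star (τ (x + star x)) = τ (x + star x) :=
    hτ.map_isSelfAdjoint (add_mem hx (star_mem hx)) (IsSelfAdjoint.add_star_self x)
  have h2 : star (τ (Complex.I • (x - star x))) = τ (Complex.I • (x - star x)) := by
    refine hτ.map_isSelfAdjoint (VonNeumannAlgebra.smul_mem _ (sub_mem hx (star_mem hx))) ?_
    rw [isSelfAdjoint_iff, star_smul, star_sub, star_star, Complex.star_def, Complex.conj_I,
      neg_smul, ← smul_neg, neg_sub]
  rw [map_smul, star_smul, Complex.star_def, Complex.conj_I, neg_smul, ← smul_neg] at h2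
  have h3 := smul_right_injective _ Complex.I_ne_zero h2
  simp only [map_add, map_sub, star_add, star_sub] at h1 h3
  have h4 : (2 : ℂ) • τ (star x) = (2 : ℂ) • star (τ x) := by
    rw [two_smul, two_smul]
    linear_combination (norm := module) (-1 : ℤ) • h1 + h3
  exact smul_right_injective _ (two_ne_zero' ℂ) h4

theorem stmt9 (M : VonNeumannAlgebra H) (ζ : H) (hζ : ‖ζ‖ = 1)
    (hcyc : IsCyclicVector M ζ) (hsep : IsSeparatingVector M ζ)
    (τ : (H →L[ℂ] H) →ₗ[ℂ] (H →L[ℂ] H))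
    (hpos : IsPositiveMapOn M τ)
    -- Kadison–Schwarz inequality: `τ(x*)τ(x) ≤ τ(x*x)` for all `x ∈ M`.
    (hKS : ∀ x ∈ M, (τ (star x * x) - τ (star x) * τ x).IsPositive)
    -- `φ ∘ τ ≤ φ` on positive elements:
    (hstate : ∀ x ∈ M, x.IsPositive → ⟪ζ, τ x ζ⟫ ≤ ⟪ζ, x ζ⟫) :
    (∀ x ∈ M, τ x = x → τ (star x * x) = star x * x) ∧
    (∀ x ∈ M, ∀ y ∈ M, τ x = x → τ y = y →
      τ (star x * y) = τ (star x) * τ y ∧ τ (star x * y) = star x * y) ∧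
    -- consequently `N = {x ∈ M : τ(x) = x}` is closed under adjoints and products:
    (∀ x ∈ M, τ x = x → τ (star x) = star x) ∧
    (∀ x ∈ M, ∀ y ∈ M, τ x = x → τ y = y → τ (x * y) = x * y) := by
  have hstar : ∀ x ∈ M, τ x = x → τ (star x) = star x := fun x hx h ↦ by
    rw [hpos.map_star hx, h]
  have hsq : ∀ x ∈ M, τ x = x → τ (star x * x) = star x * x := by
    intro x hx h
    have hxx : star x * x ∈ M := mul_mem (star_mem hx) hx
    have hp := hKS x hx
    rw [hstar x hx h, h] at hp
    have hle := hstate _ hxx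
      ((ContinuousLinearMap.nonneg_iff_isPositive _).mp (star_mul_self_nonneg x))
    have h0 : ⟪ζ, (τ (star x * x) - star x * x) ζ⟫ = 0 := by
      refine le_antisymm ?_ (hp.inner_nonneg_right ζ)
      rwa [sub_apply, inner_sub_right, sub_nonpos]
    exact sub_eq_zero.mp <| hsep _ (sub_mem (hpos.1 _ hxx) hxx)
      (hp.apply_eq_zero_of_inner_eq_zero h0)
  have hmul : ∀ x ∈ M, ∀ y ∈ M, τ x = x → τ y = y → τ (star x * y) = star x * y := by
    intro x hx y hy h h'
    have e1 := hsq (x + y) (add_mem hx hy) (by rw [map_add, h, h'])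
    have e2 := hsq (x + Complex.I • y) (add_mem hx (VonNeumannAlgebra.smul_mem _ hy))
      (by rw [map_add, map_smul, h, h'])
    simp only [star_add, star_smul, add_mul, mul_add, map_add, hsq x hx h, hsq y hy h',
      Complex.star_def, Complex.conj_I, smul_mul_assoc, mul_smul_comm, map_smul] at e1 e2
    have h4 : (2 * Complex.I) • τ (star x * y) = (2 * Complex.I) • (star x * y) := by
      linear_combination (norm := skip) Complex.I • e1 + e2
      match_scalars <;> ring_nf
    exact smul_right_injective _ (by simp) h4
  refine ⟨hsq, fun x hx y hy h h' ↦ ⟨?_, hmul x hx y hy h h'⟩, hstar, fun x hx y hy h h' ↦ ?_⟩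
  · rw [hmul x hx y hy h h', hstar x hx h, h']
  · simpa using hmul (star x) (star_mem hx) y hy (hstar x hx h) h'
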